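/- There exists a real polynomial u such that the even Schwartz function f(x) = u(x²) e^{−x²/2} satisfies: (i) f(x) ≤ 0 for all x ∈ ℝ; (ii) f̂(√(λ − 1/4)) ≥ 0.447759 for all λ ∈ [1.857, 2.71]; (iii) f̂(√(λ − 1/4)) ≥ 0 for all λ ≥ 2.71; (iv) (1/0.447759) · ( 4 ∫₀^∞ ξ f̂(ξ) tanh(πξ) dξ − (1/√(2π)) ∫_ℝ f(x) cosh(x/2) dx ) ≤ 8.967. -/

import Mathlib

open Real MeasureTheory

/-- The even function `x ↦ u(x²) e^{-x²/2}` associated to a real polynomial `u`. -/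
noncomputable def gaussPoly (u : Polynomial ℝ) (x : ℝ) : ℝ :=
  u.eval (x ^ 2) * Real.exp (-x ^ 2 / 2)

/-- The Fourier transform `f̂(ξ) = (1/√(2π)) ∫_ℝ f(x) e^{-iξx} dx` of an even real-valued
function, written in its real form `(1/√(2π)) ∫_ℝ f(x) cos(ξ x) dx`. -/
noncomputable def evenFT (f : ℝ → ℝ) (ξ : ℝ) : ℝ :=
  (1 / Real.sqrt (2 * π)) * ∫ x : ℝ, f x * Real.cos (ξ * x)

/-! ### Rational polynomials as coefficient lists -/

namespace CoeffList

/-- The value at a real point of the polynomial with the given coefficients, constant term first. -/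
noncomputable def ev : List ℚ → ℝ → ℝ
  | [], _ => 0
  | c :: p, x => c + x * ev p x

/-- The value at a rational point. -/
def evQ : List ℚ → ℚ → ℚ
  | [], _ => 0
  | c :: p, x => c + x * evQ p x

/-- The coefficients of the sum. -/
def add : List ℚ → List ℚ → List ℚ
  | [], q => q
  | c :: p, [] => c :: p
  | c :: p, d :: q => (c + d) :: add p q

/-- The coefficients of a scalar multiple. -/
def smul (a : ℚ) : List ℚ → List ℚ
  | [] => []
  | c :: p => (a * c) :: smul a p

/-- The coefficients of the product. -/
def mul : List ℚ → List ℚ → List ℚ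
  | [], _ => []
  | c :: p, q => add (smul c q) (0 :: mul p q)

/-- The coefficients of `p(-x)`. -/
def reflect : List ℚ → List ℚ
  | [] => []
  | c :: p => c :: smul (-1) (reflect p)

/-- The coefficients of `p(x²)`. -/
def compSq : List ℚ → List ℚ
  | [] => []
  | c :: p => c :: 0 :: compSq p

/-- The coefficients of `(p(x) - p(c)) / (x - c)`. -/
def quotient (c : ℚ) : List ℚ → List ℚ
  | [] => []
  | _ :: p => evQ p c :: quotient c p

/-- The primitive of `x ^ k p(x)` divided by `x ^ (k + 1)`. -/
def primitive : ℕ → List ℚ → List ℚ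
  | _, [] => []
  | k, c :: p => c / (k + 1) :: primitive (k + 1) p

/-- The coefficients of the derivative. -/
def deriv : List ℚ → List ℚ
  | [] => []
  | _ :: p => add p (0 :: deriv p)

/-- The sum `b⁻¹ p + b⁻² p' + ⋯` of `n` terms, which solves `b g - g' = p` if `p` has degree less
than `n`. -/
def expPrimitive (b : ℚ) : ℕ → List ℚ → List ℚ
  | 0, _ => []
  | n + 1, p => smul b⁻¹ (add p (expPrimitive b n (deriv p)))

/-- The product of the squares `(x - s)²`. -/
def squares : List ℚ → List ℚ
  | [] => [1]
  | s :: l => mul [s ^ 2, -2 * s, 1] (squares l)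

/-- The numerator of `p(num / den)` over the denominator `den ^ (p.length - 1)`. -/
def subst (num den : List ℚ) : List ℚ → List ℚ
  | [] => []
  | c :: p => add (smul c (p.foldr (fun _ r => mul den r) [1])) (mul num (subst num den p))

/-- A test for all coefficients being nonnegative. -/
def nonnegCoeffs (p : List ℚ) : Bool := p.all fun c => decide (0 ≤ c.num)

/-- A test for all coefficients being zero. -/
def isZero (p : List ℚ) : Bool := p.all fun c => decide (c.num = 0)

/-- A test for two coefficient lists to define the same polynomial. -/
def same (p q : List ℚ) : Bool := isZero (add p (smul (-1) q))

@[simp] theorem ev_nil (x : ℝ) : ev [] x = 0 := rfl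

@[simp] theorem ev_cons (c : ℚ) (p : List ℚ) (x : ℝ) : ev (c :: p) x = c + x * ev p x := rfl

@[simp] theorem ev_add (p q : List ℚ) (x : ℝ) : ev (add p q) x = ev p x + ev q x := by
  induction p generalizing q with
  | nil => simp [add]
  | cons c p ih =>
    cases q with
    | nil => simp [add]
    | cons d q => simp [add, ih]; ring

@[simp] theorem ev_smul (a : ℚ) (p : List ℚ) (x : ℝ) : ev (smul a p) x = a * ev p x := by
  induction p with
  | nil => simp [smul]
  | cons c p ih => simp [smul, ih]; ring

@[simp] theorem ev_mul (p q : List ℚ) (x : ℝ) : ev (mul p q) x = ev p x * ev q x := by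
  induction p with
  | nil => simp [mul]
  | cons c p ih => simp [mul, ih]; ring

@[simp] theorem ev_reflect (p : List ℚ) (x : ℝ) : ev (reflect p) x = ev p (-x) := by
  induction p with
  | nil => simp [reflect]
  | cons c p ih => simp [reflect, ih]

@[simp] theorem ev_compSq (p : List ℚ) (x : ℝ) : ev (compSq p) x = ev p (x ^ 2) := by
  induction p with
  | nil => simp [compSq]
  | cons c p ih => simp [compSq, ih]; ring

theorem ev_squares_nonneg (l : List ℚ) (x : ℝ) : 0 ≤ ev (squares l) x := by
  induction l with
  | nil => simp [squares]
  | cons s l ih =>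
    have h : ev [s ^ 2, -2 * s, 1] x = (x - s) ^ 2 := by simp; ring
    rw [squares, ev_mul, h]
    positivity

theorem ev_ratCast (p : List ℚ) (x : ℚ) : ev p (x : ℝ) = (evQ p x : ℚ) := by
  induction p with
  | nil => simp [evQ]
  | cons c p ih => simp [evQ, ih]

theorem hasDerivAt_ev (p : List ℚ) (x : ℝ) : HasDerivAt (ev p) (ev (deriv p) x) x := by
  induction p with
  | nil => exact hasDerivAt_const x 0
  | cons c p ih =>
    have h := ((hasDerivAt_id x).mul ih).const_add (c : ℝ)
    refine h.congr_deriv ?_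
    simp [deriv]

@[fun_prop] theorem continuous_ev (p : List ℚ) : Continuous (ev p) :=
  continuous_iff_continuousAt.2 fun x => (hasDerivAt_ev p x).continuousAt

theorem ev_nonneg_of_coeffs {p : List ℚ} (h : nonnegCoeffs p = true) {x : ℝ} (hx : 0 ≤ x) :
    0 ≤ ev p x := by
  induction p with
  | nil => simp
  | cons c p ih =>
    rw [nonnegCoeffs, List.all_cons, Bool.and_eq_true, decide_eq_true_eq, Rat.num_nonneg] at h
    have hc : (0 : ℝ) ≤ c := by exact_mod_cast h.1
    have := ih h.2
    rw [ev_cons]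
    positivity

theorem ev_eq_zero_of_isZero {p : List ℚ} (h : isZero p = true) (x : ℝ) : ev p x = 0 := by
  induction p with
  | nil => simp
  | cons c p ih =>
    rw [isZero, List.all_cons, Bool.and_eq_true, decide_eq_true_eq, Rat.num_eq_zero] at h
    simp [h.1, ih h.2]

theorem ev_congr {p q : List ℚ} (h : same p q = true) (x : ℝ) : ev p x = ev q x := by
  have := ev_eq_zero_of_isZero h x
  simp only [ev_add, ev_smul] at this
  push_cast at this
  linarith

theorem ev_subst (num den p : List ℚ) {x y : ℝ} (h : x * ev den y = ev num y) :
    ev den y ^ p.length * ev p x = ev den y * ev (subst num den p) y := by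
  have hpow : ∀ p : List ℚ, ev (p.foldr (fun _ r => mul den r) [1]) y = ev den y ^ p.length := by
    intro p
    induction p with
    | nil => simp
    | cons c p ih => simp [ih, pow_succ']
  induction p with
  | nil => simp [subst]
  | cons c p ih =>
    simp only [subst, ev_cons, ev_add, ev_smul, ev_mul, hpow, List.length_cons, ← h]
    linear_combination x * ev den y * ih

theorem ev_nonneg_of_subst {num den p : List ℚ} (hc : nonnegCoeffs (subst num den p) = true)
    {x y : ℝ} (hy : 0 ≤ y) (hden : 0 < ev den y) (h : x * ev den y = ev num y) : 0 ≤ ev p x := by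
  have h1 := ev_subst num den p h
  have h2 := ev_nonneg_of_coeffs hc hy
  have h3 : 0 ≤ ev den y ^ p.length * ev p x := h1 ▸ mul_nonneg hden.le h2
  exact nonneg_of_mul_nonneg_right h3 (by positivity)

/-- A test for nonnegativity on `[a, b)`, where `b` is the last of the listed breakpoints: on each
piece `[c, d)` the numerator after the substitution `x = (c + d y) / (1 + y)` has nonnegative
coefficients. -/
def nonnegOn (p : List ℚ) : ℚ → List ℚ → Bool
  | _, [] => true
  | a, b :: l => nonnegCoeffs (subst [a, b] [1, 1] p) && nonnegOn p b l

theorem ev_nonneg_of_nonnegOn {p : List ℚ} (a : ℚ) (l : List ℚ) (hc : nonnegOn p a l = true)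
    {x : ℝ} (ha : (a : ℝ) ≤ x) (hb : x < (l.getLastD a : ℚ)) : 0 ≤ ev p x := by
  induction l generalizing a with
  | nil => exact absurd (ha.trans_lt hb) (by simp)
  | cons b l ih =>
    rw [nonnegOn, Bool.and_eq_true] at hc
    rcases le_or_gt (b : ℝ) x with h | h
    · exact ih b hc.2 h (by rwa [List.getLastD_cons] at hb)
    · have hb : 0 < (b : ℝ) - x := sub_pos.2 h
      have ha : 0 ≤ x - (a : ℝ) := sub_nonneg.2 ha
      have hy : 0 ≤ (x - a) / (b - x) := by positivity
      refine ev_nonneg_of_subst hc.1 hy (by simp; positivity) ?_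
      simp
      field_simp
      ring

theorem ev_nonneg_of_le {p : List ℚ} (a : ℚ)
    (hc : nonnegCoeffs (subst [a, 1] [1] p) = true) {x : ℝ} (hx : (a : ℝ) ≤ x) :
    0 ≤ ev p x :=
  ev_nonneg_of_subst hc (sub_nonneg.2 hx) (by simp) (by simp)

/-- The real polynomial with the given coefficients. -/
noncomputable def toPoly : List ℚ → Polynomial ℝ
  | [] => 0
  | c :: p => Polynomial.C (c : ℝ) + Polynomial.X * toPoly p

@[simp] theorem eval_toPoly (p : List ℚ) (x : ℝ) : (toPoly p).eval x = ev p x := by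
  induction p with
  | nil => simp [toPoly]
  | cons c p ih => simp [toPoly, ih]

theorem intervalIntegral_ev {p g : List ℚ} (h : same (deriv g) p = true) (a b : ℝ) :
    ∫ x in a..b, ev p x = ev g b - ev g a := by
  refine intervalIntegral.integral_eq_sub_of_hasDerivAt (fun x _ => ?_)
    ((continuous_ev p).intervalIntegrable _ _)
  rw [← ev_congr h]
  exact hasDerivAt_ev g x

end CoeffList

/-! ### Gaussian moments -/

open CoeffList

theorem integrable_pow_mul_cexp_neg_sq_div_two (n : ℕ) (z : ℂ) :
    Integrable fun x : ℝ => (x : ℂ) ^ n * Complex.exp (-(x : ℂ) ^ 2 / 2 + z * x) := by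
  have hquad : ∀ c : ℂ, Integrable fun x : ℝ => Complex.exp (-(x : ℂ) ^ 2 / 2 + c * x) := by
    intro c
    have h := integrable_cexp_quadratic' (b := -(1 / 2)) (by norm_num) c 0
    refine h.congr (ae_of_all _ fun x => ?_)
    ring_nf
  have hdom := (((hquad (z + 1)).norm).add (hquad (z - 1)).norm).const_mul (n.factorial : ℝ)
  refine hdom.mono' (by fun_prop) (ae_of_all _ fun x => ?_)
  have h1 : |x| ^ n ≤ n.factorial * (Real.exp x + Real.exp (-x)) := by
    have h := Real.pow_div_factorial_le_exp |x| (abs_nonneg x) n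
    rw [div_le_iff₀ (by positivity)] at h
    calc |x| ^ n ≤ Real.exp |x| * n.factorial := h
      _ ≤ (Real.exp x + Real.exp (-x)) * n.factorial := by gcongr; exact Real.exp_abs_le x
      _ = _ := mul_comm _ _
  have h2 : ∀ e : ℝ, Real.exp (e * x) * ‖Complex.exp (-(x : ℂ) ^ 2 / 2 + z * x)‖ =
      ‖Complex.exp (-(x : ℂ) ^ 2 / 2 + (z + e) * x)‖ := by
    intro e
    rw [show -(x : ℂ) ^ 2 / 2 + (z + e) * x = ((e * x : ℝ) : ℂ) + (-(x : ℂ) ^ 2 / 2 + z * x) by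
      push_cast; ring, Complex.exp_add ((e * x : ℝ) : ℂ), norm_mul, Complex.norm_exp_ofReal]
  have h3 := h2 1
  have h4 := h2 (-1)
  simp only [one_mul, neg_mul, Complex.ofReal_one, Complex.ofReal_neg, ← sub_eq_add_neg] at h3 h4
  rw [norm_mul, norm_pow, Complex.norm_real, Real.norm_eq_abs, Pi.add_apply, ← h3, ← h4]
  calc _ ≤ n.factorial * (Real.exp x + Real.exp (-x)) * _ := by gcongr
    _ = _ := by ring

/-- The moments `∫ xⁿ e^{-x²/2 + zx} dx`. -/
noncomputable def gaussMoment (n : ℕ) (z : ℂ) : ℂ :=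
  ∫ x : ℝ, (x : ℂ) ^ n * Complex.exp (-(x : ℂ) ^ 2 / 2 + z * x)

theorem gaussMoment_zero (z : ℂ) :
    gaussMoment 0 z = (Real.sqrt (2 * π) : ℂ) * Complex.exp (z ^ 2 / 2) := by
  have h := integral_cexp_quadratic (b := -(1 / 2)) (by norm_num) z 0
  have hs : (Real.sqrt (2 * π) : ℂ) = (π / -(-(1 / 2)) : ℂ) ^ (1 / 2 : ℂ) := by
    rw [Real.sqrt_eq_rpow, Complex.ofReal_cpow (by positivity)]
    congr 1
    · push_cast; ring
    · norm_num
  rw [gaussMoment, hs]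
  convert h using 3
  · ring_nf
  · ring_nf

theorem hasDerivAt_pow_mul_cexp (n : ℕ) (z : ℂ) (x : ℝ) :
    HasDerivAt (fun x : ℝ => (x : ℂ) ^ n * Complex.exp (-(x : ℂ) ^ 2 / 2 + z * x))
      (n * ((x : ℂ) ^ (n - 1) * Complex.exp (-(x : ℂ) ^ 2 / 2 + z * x)) +
        z * ((x : ℂ) ^ n * Complex.exp (-(x : ℂ) ^ 2 / 2 + z * x)) -
        (x : ℂ) ^ (n + 1) * Complex.exp (-(x : ℂ) ^ 2 / 2 + z * x)) x := by
  have hx := Complex.ofRealCLM.hasDerivAt (x := x)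
  simp only [Complex.ofRealCLM_apply, Complex.ofReal_one] at hx
  have h := (hx.pow n).mul ((((hx.pow 2).neg.div_const 2).add (hx.const_mul z)).cexp)
  refine h.congr_deriv ?_
  simp
  ring

theorem gaussMoment_succ (n : ℕ) (z : ℂ) :
    gaussMoment (n + 1) z = z * gaussMoment n z + n * gaussMoment (n - 1) z := by
  have hi := fun m => integrable_pow_mul_cexp_neg_sq_div_two m z
  have h1 := (hi (n - 1)).const_mul (n : ℂ)
  have h2 := (hi n).const_mul z
  have h12 : Integrable fun x : ℝ =>
      n * ((x : ℂ) ^ (n - 1) * Complex.exp (-(x : ℂ) ^ 2 / 2 + z * x)) +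
        z * ((x : ℂ) ^ n * Complex.exp (-(x : ℂ) ^ 2 / 2 + z * x)) := h1.add h2
  have h := integral_eq_zero_of_hasDerivAt_of_integrable (hasDerivAt_pow_mul_cexp n z)
    (h12.sub (hi (n + 1))) (hi n)
  rw [integral_sub h12 (hi (n + 1)), integral_add h1 h2, integral_const_mul,
    integral_const_mul] at h
  simp only [gaussMoment]
  linear_combination -h

namespace CoeffList

/-- For even moments `k, k + 1, …` weighted by the coefficients in the list: if `A` and `B` are
the polynomials in `w = z²` with moment `2k` equal to `A` and moment `2k + 1` equal to `z B`
(both up to `√(2π) e^{z²/2}`), the result is the polynomial in `w` giving the weighted sum. -/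
def momentSum : ℕ → List ℚ → List ℚ → List ℚ → List ℚ
  | _, _, _, [] => []
  | k, A, B, c :: p =>
    let A' := add (0 :: B) (smul (2 * k + 1) A)
    add (smul c A) (momentSum (k + 1) A' (add A' (smul (2 * k + 2) B)) p)

/-- The coefficients of `P` such that `∫ p(x²) e^{-x²/2 + zx} dx = √(2π) e^{z²/2} P(z²)`. -/
def gaussTransform (p : List ℚ) : List ℚ := momentSum 0 [1] [1] p

end CoeffList

theorem integral_evenPoly_mul_cexp_aux (p : List ℚ) (z : ℂ) (w : ℝ) (hw : z ^ 2 = w) (k : ℕ)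
    (A B : List ℚ)
    (hA : gaussMoment (2 * k) z = Real.sqrt (2 * π) * Complex.exp (z ^ 2 / 2) * ev A w)
    (hB : gaussMoment (2 * k + 1) z = Real.sqrt (2 * π) * Complex.exp (z ^ 2 / 2) * (z * ev B w)) :
    Integrable (fun x : ℝ => (x : ℂ) ^ (2 * k) * ev p (x ^ 2) *
      Complex.exp (-(x : ℂ) ^ 2 / 2 + z * x)) ∧
    ∫ x : ℝ, (x : ℂ) ^ (2 * k) * ev p (x ^ 2) * Complex.exp (-(x : ℂ) ^ 2 / 2 + z * x) =
      Real.sqrt (2 * π) * Complex.exp (z ^ 2 / 2) * ev (momentSum k A B p) w := by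
  induction p generalizing k A B with
  | nil => simp [momentSum]
  | cons c p ih =>
    have hA' : gaussMoment (2 * (k + 1)) z = Real.sqrt (2 * π) * Complex.exp (z ^ 2 / 2) *
        ev (add (0 :: B) (smul (2 * k + 1) A)) w := by
      rw [show 2 * (k + 1) = 2 * k + 1 + 1 by ring, gaussMoment_succ, hB,
        show 2 * k + 1 - 1 = 2 * k by omega, hA]
      simp [← hw]
      ring
    have hB' : gaussMoment (2 * (k + 1) + 1) z = Real.sqrt (2 * π) * Complex.exp (z ^ 2 / 2) *
        (z * ev (add (add (0 :: B) (smul (2 * k + 1) A)) (smul (2 * k + 2) B)) w) := by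
      rw [gaussMoment_succ, hA', show 2 * (k + 1) - 1 = 2 * k + 1 by omega, hB]
      simp
      ring
    obtain ⟨hi, he⟩ := ih (k + 1) _ _ hA' hB'
    have h0 := (integrable_pow_mul_cexp_neg_sq_div_two (2 * k) z).const_mul (c : ℂ)
    have hsplit : (fun x : ℝ => (x : ℂ) ^ (2 * k) * ev (c :: p) (x ^ 2) *
        Complex.exp (-(x : ℂ) ^ 2 / 2 + z * x)) = fun x : ℝ =>
        (c : ℂ) * ((x : ℂ) ^ (2 * k) * Complex.exp (-(x : ℂ) ^ 2 / 2 + z * x)) +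
        (x : ℂ) ^ (2 * (k + 1)) * ev p (x ^ 2) * Complex.exp (-(x : ℂ) ^ 2 / 2 + z * x) := by
      ext x
      simp
      ring
    rw [hsplit]
    refine ⟨h0.add hi, ?_⟩
    rw [integral_add h0 hi, he, integral_const_mul, ← gaussMoment, hA]
    simp [momentSum]
    ring

theorem integral_evenPoly_mul_cexp (p : List ℚ) (z : ℂ) (w : ℝ) (hw : z ^ 2 = w) :
    Integrable (fun x : ℝ => (ev p (x ^ 2) : ℂ) * Complex.exp (-(x : ℂ) ^ 2 / 2 + z * x)) ∧
    ∫ x : ℝ, (ev p (x ^ 2) : ℂ) * Complex.exp (-(x : ℂ) ^ 2 / 2 + z * x) =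
      Real.sqrt (2 * π) * Complex.exp (z ^ 2 / 2) * ev (gaussTransform p) w := by
  have h := integral_evenPoly_mul_cexp_aux p z w hw 0 [1] [1]
    (by simp [gaussMoment_zero]) (by simp [gaussMoment_succ, gaussMoment_zero]; ring)
  simpa [gaussTransform] using h

theorem evenFT_gaussPoly (p : List ℚ) (ξ : ℝ) :
    evenFT (gaussPoly (toPoly p)) ξ = ev (gaussTransform p) (-ξ ^ 2) * Real.exp (-ξ ^ 2 / 2) := by
  have hz : (ξ * Complex.I) ^ 2 = ((-ξ ^ 2 : ℝ) : ℂ) := by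
    rw [mul_pow, Complex.I_sq]; push_cast; ring
  obtain ⟨hi, he⟩ := integral_evenPoly_mul_cexp p (ξ * Complex.I) (-ξ ^ 2) hz
  have hre := integral_re hi
  have hint : ∀ x : ℝ, RCLike.re ((ev p (x ^ 2) : ℂ) *
      Complex.exp (-(x : ℂ) ^ 2 / 2 + ξ * Complex.I * x)) =
      gaussPoly (toPoly p) x * Real.cos (ξ * x) := by
    intro x
    rw [show -(x : ℂ) ^ 2 / 2 + ξ * Complex.I * x =
      ((-x ^ 2 / 2 : ℝ) : ℂ) + ((ξ * x : ℝ) : ℂ) * Complex.I by push_cast; ring, Complex.exp_add,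
      ← Complex.ofReal_exp, ← mul_assoc, ← Complex.ofReal_mul]
    rw [RCLike.re_to_complex, Complex.re_ofReal_mul, Complex.exp_ofReal_mul_I_re, gaussPoly,
      eval_toPoly]
  have hs : Real.sqrt (2 * π) ≠ 0 := by positivity
  simp only [hint] at hre
  rw [evenFT, hre, he, hz, show ((-ξ ^ 2 : ℝ) : ℂ) / 2 = ((-ξ ^ 2 / 2 : ℝ) : ℂ) by push_cast; ring,
    ← Complex.ofReal_exp, ← Complex.ofReal_mul, ← Complex.ofReal_mul]
  simp only [RCLike.re_to_complex, Complex.ofReal_re]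
  field_simp

theorem integral_gaussPoly_mul_cosh (p : List ℚ) (c : ℝ) :
    (1 / Real.sqrt (2 * π)) * ∫ x : ℝ, gaussPoly (toPoly p) x * Real.cosh (c * x) =
      ev (gaussTransform p) (c ^ 2) * Real.exp (c ^ 2 / 2) := by
  have hexp : ∀ e : ℝ, e ^ 2 = c ^ 2 →
      Integrable (fun x : ℝ => gaussPoly (toPoly p) x * Real.exp (e * x)) ∧
      ∫ x : ℝ, gaussPoly (toPoly p) x * Real.exp (e * x) =
        Real.sqrt (2 * π) * Real.exp (c ^ 2 / 2) * ev (gaussTransform p) (c ^ 2) := by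
    intro e hec
    obtain ⟨hi, he⟩ := integral_evenPoly_mul_cexp p e (c ^ 2) (by exact_mod_cast hec)
    have hfun : (fun x : ℝ => (ev p (x ^ 2) : ℂ) * Complex.exp (-(x : ℂ) ^ 2 / 2 + e * x)) =
        fun x : ℝ => ((gaussPoly (toPoly p) x * Real.exp (e * x) : ℝ) : ℂ) := by
      ext x
      simp [gaussPoly, Complex.exp_add, mul_assoc]
    rw [hfun] at hi he
    rw [integral_complex_ofReal] at he
    have hre := hi.re
    simp only [RCLike.re_to_complex, Complex.ofReal_re] at hre
    refine ⟨hre, ?_⟩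
    have he' : (e : ℂ) ^ 2 = ((c ^ 2 : ℝ) : ℂ) := by exact_mod_cast hec
    rw [he'] at he
    exact_mod_cast he
  obtain ⟨i1, e1⟩ := hexp c rfl
  obtain ⟨i2, e2⟩ := hexp (-c) (by ring)
  have hs : Real.sqrt (2 * π) ≠ 0 := by positivity
  have : ∀ x : ℝ, gaussPoly (toPoly p) x * Real.cosh (c * x) =
      (gaussPoly (toPoly p) x * Real.exp (c * x) + gaussPoly (toPoly p) x * Real.exp (-c * x)) / 2 := by
    intro x
    rw [Real.cosh_eq]
    ring_nf
  simp only [this]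
  rw [integral_div, integral_add i1 i2, e1, e2]
  field_simp
  ring
/-! ### Bounds for the hyperbolic tangent -/

theorem Real.tanh_eq_exp_two_mul (x : ℝ) :
    Real.tanh x = (Real.exp (2 * x) - 1) / (Real.exp (2 * x) + 1) := by
  have h : Real.exp (2 * x) = Real.exp x * Real.exp x := by rw [← Real.exp_add]; ring_nf
  have hinv : Real.exp (-x) * Real.exp x = 1 := by rw [← Real.exp_add]; simp
  rw [Real.tanh_eq_sinh_div_cosh, Real.sinh_eq, Real.cosh_eq, h,
    div_eq_div_iff (by positivity) (by positivity)]
  linear_combination -Real.exp x * hinv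

/-- A subsolution of the differential equation of `x ↦ tanh (π x)` lies below it. -/
theorem le_tanh_pi_mul {l l' : ℝ → ℝ} {a : ℝ} (hl : ∀ x, HasDerivAt l (l' x) x) (h0 : l 0 = 0)
    (hpos : ∀ x ∈ Set.Icc 0 a, 0 ≤ l x)
    (hd : ∀ x ∈ Set.Icc 0 a, l' x ≤ π * (1 - l x ^ 2)) {x : ℝ} (hx : x ∈ Set.Icc 0 a) :
    l x ≤ Real.tanh (π * x) := by
  have hderiv : ∀ y ∈ Set.Icc 0 a,
      HasDerivAt (fun y => (1 - l y) * Real.exp (2 * (π * y)) / (1 + l y))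
        (2 * Real.exp (2 * (π * y)) * (π * (1 - l y ^ 2) - l' y) / (1 + l y) ^ 2) y := by
    intro y hy
    have hne : 1 + l y ≠ 0 := by linarith [hpos y hy]
    have he : HasDerivAt (fun y => Real.exp (2 * (π * y))) (Real.exp (2 * (π * y)) * (2 * π)) y := by
      have := (((hasDerivAt_id y).const_mul π).const_mul 2).exp
      simpa using this
    refine ((((hl y).const_sub 1).mul he).div ((hl y).const_add 1) hne).congr_deriv ?_
    simp only [Pi.mul_apply]
    field_simp
    ring
  have hmono : MonotoneOn (fun y => (1 - l y) * Real.exp (2 * (π * y)) / (1 + l y))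
      (Set.Icc 0 a) := by
    refine monotoneOn_of_hasDerivWithinAt_nonneg (convex_Icc 0 a)
      (fun y hy => (hderiv y hy).continuousAt.continuousWithinAt)
      (fun y hy => (hderiv y (interior_subset hy)).hasDerivWithinAt) fun y hy => ?_
    have := sub_nonneg.2 (hd y (interior_subset hy))
    positivity
  have h := hmono ⟨le_rfl, hx.1.trans hx.2⟩ hx hx.1
  have hl1 : 0 < 1 + l x := by linarith [hpos x hx]
  simp only [h0, mul_zero, Real.exp_zero, sub_zero, add_zero, mul_one, div_one] at h
  rw [le_div_iff₀ hl1] at h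
  rw [Real.tanh_eq_exp_two_mul, le_div_iff₀ (by positivity)]
  linarith

theorem tanh_pi_mul_le {x : ℝ} (hx : 0.7998 ≤ x) :
    Real.tanh (π * x) ≤ 1 - 2 / 17 * Real.exp (-(7 / 2) * x ^ 2) := by
  have hpi : 2 / 7 * π ^ 2 ≤ 2.82 := by nlinarith [Real.pi_lt_d6, Real.pi_pos]
  have hc : Real.exp (2 / 7 * π ^ 2) ≤ 16.8 := by
    have h : Real.exp 0.94 ≤ 2.56 := by
      refine (Real.exp_bound' (n := 6) (by norm_num) (by norm_num) (by norm_num)).trans ?_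
      norm_num [Finset.sum_range_succ, Nat.factorial]
    calc Real.exp (2 / 7 * π ^ 2) ≤ Real.exp 2.82 := Real.exp_le_exp.2 hpi
      _ = Real.exp 0.94 ^ 3 := by rw [← Real.exp_nat_mul]; norm_num
      _ ≤ 2.56 ^ 3 := by gcongr
      _ ≤ 16.8 := by norm_num
  have h1 : Real.exp (2 * (π * x)) ≤ 16.8 * Real.exp (7 / 2 * x ^ 2) := by
    calc Real.exp (2 * (π * x)) ≤ Real.exp (2 / 7 * π ^ 2 + 7 / 2 * x ^ 2) := by
          apply Real.exp_le_exp.2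
          nlinarith [sq_nonneg (2 * π - 7 * x)]
      _ = Real.exp (2 / 7 * π ^ 2) * Real.exp (7 / 2 * x ^ 2) := Real.exp_add _ _
      _ ≤ _ := by gcongr
  have h2 : 1 ≤ 0.2 * Real.exp (7 / 2 * x ^ 2) := by
    have := Real.quadratic_le_exp_of_nonneg (x := 7 / 2 * x ^ 2) (by positivity)
    have hx2 : 0.6 ≤ x ^ 2 := by nlinarith
    nlinarith
  rw [Real.tanh_eq_exp_two_mul, div_le_iff₀ (by positivity), neg_mul, Real.exp_neg]
  have h3 : 0 < Real.exp (7 / 2 * x ^ 2) := Real.exp_pos _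
  have h4 : (Real.exp (7 / 2 * x ^ 2))⁻¹ * (Real.exp (2 * (π * x)) + 1) ≤ 17 := by
    rw [inv_mul_le_iff₀ h3]
    linarith
  linarith

/-! ### Gaussian tails -/

theorem integrable_pow_mul_exp_neg_mul_sq {b : ℝ} (hb : 0 < b) (n : ℕ) :
    Integrable fun x : ℝ => x ^ n * Real.exp (-b * x ^ 2) := by
  have h := integrable_rpow_mul_exp_neg_mul_sq hb (s := n) (by linarith [n.cast_nonneg (α := ℝ)])
  simpa only [Real.rpow_natCast] using h

theorem integrable_pow_mul_ev_sq_mul_exp (p : List ℚ) {b : ℝ} (hb : 0 < b) (k : ℕ) :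
    Integrable fun x : ℝ => x ^ k * ev p (x ^ 2) * Real.exp (-b * x ^ 2) := by
  induction p generalizing k with
  | nil => simp
  | cons c p ih =>
    refine (((integrable_pow_mul_exp_neg_mul_sq hb k).const_mul (c : ℝ)).add (ih (k + 2))).congr
      (ae_of_all _ fun x => ?_)
    simp
    ring

theorem integral_Ioi_mul_ev_sq_mul_exp {b : ℚ} (hb : 0 < b) {p g : List ℚ}
    (h : same (add (smul b g) (smul (-1) (deriv g))) p = true) (a : ℝ) :
    ∫ x in Set.Ioi a, x * ev p (x ^ 2) * Real.exp (-b * x ^ 2) =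
      Real.exp (-b * a ^ 2) * ev g (a ^ 2) / 2 := by
  have hb' : (0 : ℝ) < b := by exact_mod_cast hb
  have hd : ∀ x : ℝ, HasDerivAt (fun x : ℝ => -(1 / 2) * (ev g (x ^ 2) * Real.exp (-b * x ^ 2)))
      (x * ev p (x ^ 2) * Real.exp (-b * x ^ 2)) x := by
    intro x
    have hsq : HasDerivAt (fun x : ℝ => x ^ 2) (2 * x) x := by simpa using hasDerivAt_pow 2 x
    have hg := (hasDerivAt_ev g (x ^ 2)).comp x hsq
    refine ((hg.mul (hsq.const_mul (-(b : ℝ))).exp).const_mul (-(1 / 2))).congr_deriv ?_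
    rw [← ev_congr h]
    simp
    ring
  have hi := integrable_pow_mul_ev_sq_mul_exp p hb' 1
  have hF := (integrable_pow_mul_ev_sq_mul_exp g hb' 0).const_mul (-(1 / 2) : ℝ)
  simp only [pow_one, pow_zero, one_mul] at hi hF
  rw [integral_Ioi_of_hasDerivAt_of_tendsto' (fun x _ => hd x) hi.integrableOn
    (tendsto_zero_of_hasDerivAt_of_integrableOn_Ioi (a := a) (fun x _ => hd x) hi.integrableOn
      hF.integrableOn)]
  ring

/-! ### The spectral integral -/

theorem integrable_mul_ev_sq_mul_exp_mul_tanh (p : List ℚ) :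
    Integrable fun x : ℝ =>
      x * (ev p (x ^ 2) * Real.exp (-x ^ 2 / 2)) * Real.tanh (π * x) := by
  have hi := integrable_pow_mul_ev_sq_mul_exp p (b := 1 / 2) (by norm_num) 1
  have hm : Continuous Real.tanh := by
    have : Real.tanh = fun x => Real.sinh x / Real.cosh x := funext Real.tanh_eq_sinh_div_cosh
    rw [this]
    exact Real.continuous_sinh.div Real.continuous_cosh fun x => (Real.cosh_pos x).ne'
  refine (hi.mul_bdd (c := 1) (g := fun x => Real.tanh (π * x))
    (by fun_prop) (ae_of_all _ fun x => ?_)).congr (ae_of_all _ fun x => ?_)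
  · rw [Real.norm_eq_abs]
    exact (Real.abs_tanh_lt_one _).le
  · ring_nf

theorem integral_Ioi_mul_tanh_le {p g₁ g₂ : List ℚ} {a : ℝ} (ha : 0.7998 ≤ a)
    (hp : ∀ x, a ≤ x → 0 ≤ ev p (x ^ 2))
    (h₁ : same (add (smul (1 / 2) g₁) (smul (-1) (deriv g₁))) p = true)
    (h₂ : same (add (smul 4 g₂) (smul (-1) (deriv g₂))) p = true) :
    ∫ x in Set.Ioi a, x * (ev p (x ^ 2) * Real.exp (-x ^ 2 / 2)) * Real.tanh (π * x) ≤
      Real.exp (-a ^ 2 / 2) * ev g₁ (a ^ 2) / 2 - Real.exp (-4 * a ^ 2) * ev g₂ (a ^ 2) / 17 := by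
  have e₁ := integral_Ioi_mul_ev_sq_mul_exp (by norm_num) h₁ a
  have e₂ := integral_Ioi_mul_ev_sq_mul_exp (by norm_num) h₂ a
  have i₁ := (integrable_pow_mul_ev_sq_mul_exp p (b := (1 / 2 : ℚ)) (by norm_num) 1).integrableOn
    (s := Set.Ioi a)
  have i₂ := ((integrable_pow_mul_ev_sq_mul_exp p (b := (4 : ℚ)) (by norm_num) 1).const_mul
    (2 / 17)).integrableOn (s := Set.Ioi a)
  simp only [pow_one] at i₁ i₂
  have key := setIntegral_mono_on (integrable_mul_ev_sq_mul_exp_mul_tanh p).integrableOn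
    (i₁.sub i₂) measurableSet_Ioi fun x (hx : a < x) => ?_
  · simp only [Pi.sub_apply] at key
    rw [integral_sub i₁ i₂, integral_const_mul, e₁, e₂] at key
    refine key.trans (le_of_eq ?_)
    push_cast
    ring_nf
  · have ht := tanh_pi_mul_le (ha.trans hx.le)
    have hexp : Real.exp (-(1 / 2 : ℚ) * x ^ 2) * Real.exp (-(7 / 2) * x ^ 2) =
        Real.exp (-(4 : ℚ) * x ^ 2) := by
      rw [← Real.exp_add]
      push_cast
      ring_nf
    have hx0 : 0 ≤ x := by linarith
    have hpx := hp x hx.le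
    rw [show -x ^ 2 / 2 = -(1 / 2 : ℚ) * x ^ 2 by push_cast; ring]
    calc _ ≤ x * (ev p (x ^ 2) * Real.exp (-(1 / 2 : ℚ) * x ^ 2)) *
          (1 - 2 / 17 * Real.exp (-(7 / 2) * x ^ 2)) := by gcongr
      _ = _ := by
        simp only [Pi.sub_apply]
        linear_combination (-(2 / 17) * x * ev p (x ^ 2)) * hexp

/-- A lower Taylor bound for `e^{-s/2}`. -/
def expNegHalf : List ℚ := [1, -1 / 2, 1 / 8, -1 / 48, 1 / 384, -1 / 3840, -7 / 276480]

theorem ev_expNegHalf_le {s : ℝ} (hs : s ∈ Set.Icc 0 2) : ev expNegHalf s ≤ Real.exp (-s / 2) := by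
  have habs : |-s / 2| = s / 2 := by rw [neg_div, abs_neg, abs_of_nonneg (by linarith [hs.1])]
  have h := Real.exp_bound (x := -s / 2) (n := 6) (by rw [habs]; linarith [hs.2]) (by norm_num)
  rw [habs] at h
  have h' := (abs_le.1 h).1
  norm_num [Finset.sum_range_succ, Nat.factorial] at h'
  simp [expNegHalf]
  linarith

/-- Bounds on `[0, a]` for an integrand whose transform is `(s - a²) N(s) e^{-s/2}`: here `n` is a
lower bound for `N(s) e^{-s/2}` and `l` a lower bound for `tanh (π x)`. -/
theorem intervalIntegral_mul_tanh_le {N n l : List ℚ} {a : ℝ} (ha : 0 ≤ a) (c : ℚ) (hc : a ^ 2 = c)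
    (hN : ∀ s ∈ Set.Icc 0 (a ^ 2), 0 ≤ ev N s)
    (hn : ∀ s ∈ Set.Icc 0 (a ^ 2), ev n s ≤ ev N s * Real.exp (-s / 2))
    (hl : ∀ x ∈ Set.Icc 0 a, 0 ≤ ev l x) (ht : ∀ x ∈ Set.Icc 0 a, ev l x ≤ Real.tanh (π * x)) :
    ∫ x in (0 : ℝ)..a, x * (ev (mul [-c, 1] N) (x ^ 2) * Real.exp (-x ^ 2 / 2)) *
      Real.tanh (π * x) ≤
    ∫ x in (0 : ℝ)..a, ev (mul (0 :: compSq (mul [-c, 1] n)) l) x := by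
  refine intervalIntegral.integral_mono_on ha
    (integrable_mul_ev_sq_mul_exp_mul_tanh _).intervalIntegrable
    ((continuous_ev _).intervalIntegrable _ _) fun x hx => ?_
  have hx2 : x ^ 2 ∈ Set.Icc 0 (a ^ 2) := ⟨sq_nonneg x, pow_le_pow_left₀ hx.1 hx.2 2⟩
  have h := mul_le_mul (hn _ hx2) (ht x hx) (hl x hx)
    (mul_nonneg (hN _ hx2) (Real.exp_pos _).le)
  have h' := mul_le_mul_of_nonneg_left h (mul_nonneg hx.1 (sub_nonneg.2 hx2.2))
  simp only [ev_mul, ev_cons, ev_nil, ev_compSq]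
  push_cast
  rw [hc] at h'
  linarith


/-! ### The test function -/

namespace TestFunction

/-- The cofactor of the prescribed roots of the transform. -/
def cofactor : List ℚ :=
  [298183490739587652318066559108443506397135930742828196587774562748756899462819509157367347722745631699289992519073197706698748596098132897964342536584423603571419015105612797266147727463747546117108014,
    102717561493106746759386627038142031740621411773307488613763747736637467084055556186997060595618217933482740941386735177172070123296544848794878505499996144877112722282953075052119055167425822251113500,
    52883872607271762760135247224112742034984757905585599051757589892324584661327072570378196990414365666297489199861147748421116966341460673324411645266684989721677431440926366458538633022989938135129375,
    6477579846617790894495346527916741932753095857321117284133575809284860714051519817521575543445741821468395388712428896745424537333091052805164937631900172558356650688186480511050152391379370515000000,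
    945834565818958943091080760610689143464759511209307898233495833609557055862493497431295395299977287954851441664300870303294710860180391298937847980825576370678892907134203810076079398001492306250000]

/-- The transform divided by `(s - σ) e^{-s/2}`. -/
def transformCofactor : List ℚ :=
  smul (1 / (51944547 * 10 ^ 209))
    (mul (squares [7.9, 13.75, 20.03, 30.65, 41.86, 57.57]) cofactor)

/-- The polynomial `P` with `f̂(ξ) = P(ξ²) e^{-ξ²/2}`. -/
def transform : List ℚ := mul [-0.7998 ^ 2, 1] transformCofactor

/-- The polynomial `u` with `f(x) = u(x²) e^{-x²/2}`. -/
def profile : List ℚ := reflect (gaussTransform transform)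

/-- The quotient of `-u` by its squared factors. -/
def profileCofactor : List ℚ :=
  quotient 50.44 (quotient 50.44 (quotient 19.71 (quotient 19.71 (smul (-1) profile))))

/-- A lower bound for `transformCofactor` times `e^{-s/2}` on `[0, 0.7998²]`. -/
def cofactorLower : List ℚ := [1.4823, -1.1852, 0.5844, -0.1876]

/-- A lower bound for `tanh (π x)` on `[0, 0.7998]`. -/
def tanhLower : List ℚ :=
  [0, 3.1391, 0.0042, -10.1505, -4.0946, 76.2982, -149.8308, 126.6631, -41.3971]

/-- The majorant of the integrand on `[0, 0.7998]`. -/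
def majorant : List ℚ := mul (0 :: compSq (mul [-0.7998 ^ 2, 1] cofactorLower)) tanhLower

theorem profile_eval (t : ℝ) :
    ev profile t = -(((t - 19.71) * (t - 50.44)) ^ 2 * ev profileCofactor t) := by
  have h : same profile (smul (-1) (mul (squares [19.71, 50.44]) profileCofactor)) = true := by
    decide +kernel
  rw [ev_congr h]
  simp only [squares, ev_smul, ev_mul, ev_cons, ev_nil]
  push_cast
  ring

theorem profile_nonpos {t : ℝ} (ht : 0 ≤ t) : ev profile t ≤ 0 := by
  have h : 0 ≤ ev profileCofactor t := by
    rcases lt_or_ge t 60 with h | h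
    · exact ev_nonneg_of_nonnegOn 0 [20, 60] (by decide +kernel) (by simpa using ht)
        (by simpa using h)
    · exact ev_nonneg_of_le 60 (by decide +kernel) (by simpa using h)
  rw [profile_eval, neg_nonpos]
  positivity

theorem gaussTransform_profile (w : ℝ) : ev (gaussTransform profile) w = ev transform (-w) := by
  have h : same (reflect (gaussTransform profile)) transform = true := by decide +kernel
  rw [← ev_congr h, ev_reflect, neg_neg]

theorem evenFT_eq (ξ : ℝ) :
    evenFT (gaussPoly (toPoly profile)) ξ = ev transform (ξ ^ 2) * Real.exp (-ξ ^ 2 / 2) := by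
  rw [evenFT_gaussPoly, gaussTransform_profile, neg_neg]

theorem transformCofactor_nonneg {s : ℝ} (hs : 0 ≤ s) : 0 ≤ ev transformCofactor s := by
  have h : 0 ≤ ev cofactor s := ev_nonneg_of_coeffs (by decide +kernel) hs
  rw [transformCofactor, ev_smul, ev_mul]
  exact mul_nonneg (by positivity) (mul_nonneg (ev_squares_nonneg _ _) h)

theorem transform_nonneg {s : ℝ} (hs : 0.7998 ^ 2 ≤ s) : 0 ≤ ev transform s := by
  have hσ : ev [-0.7998 ^ 2, 1] s = s - 0.7998 ^ 2 := by simp; ring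
  have h0 : 0 ≤ s := le_trans (by positivity) hs
  rw [transform, ev_mul, hσ]
  exact mul_nonneg (sub_nonneg.2 hs) (transformCofactor_nonneg h0)

theorem exp_half_le_chord {s : ℝ} (hs : s ∈ Set.Icc 1.607 2.46) :
    Real.exp (s / 2) ≤ (2.2333440 * (2.46 - s) + 3.4212296 * (s - 1.607)) / 0.853 := by
  have h1 : Real.exp 0.8035 ≤ 2.2333440 := by
    refine (Real.exp_bound' (n := 10) (by norm_num) (by norm_num) (by norm_num)).trans ?_
    norm_num [Finset.sum_range_succ, Nat.factorial]
  have h2 : Real.exp 1.23 ≤ 3.4212296 := by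
    have h : Real.exp 0.615 ≤ 1.84965660 := by
      refine (Real.exp_bound' (n := 10) (by norm_num) (by norm_num) (by norm_num)).trans ?_
      norm_num [Finset.sum_range_succ, Nat.factorial]
    calc Real.exp 1.23 = Real.exp 0.615 ^ 2 := by rw [← Real.exp_nat_mul]; norm_num
      _ ≤ 1.84965660 ^ 2 := by gcongr
      _ ≤ _ := by norm_num
  have ha : 0 ≤ (2.46 - s) / 0.853 := div_nonneg (sub_nonneg.2 hs.2) (by norm_num)
  have hb : 0 ≤ (s - 1.607) / 0.853 := div_nonneg (sub_nonneg.2 hs.1) (by norm_num)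
  have h := convexOn_exp.2 (Set.mem_univ 0.8035) (Set.mem_univ 1.23) ha hb (by ring)
  simp only [smul_eq_mul] at h
  have h3 := mul_le_mul_of_nonneg_left h1 (sub_nonneg.2 hs.2)
  have h4 := mul_le_mul_of_nonneg_left h2 (sub_nonneg.2 hs.1)
  calc Real.exp (s / 2) = Real.exp ((2.46 - s) / 0.853 * 0.8035 + (s - 1.607) / 0.853 * 1.23) := by
        ring_nf
    _ ≤ _ := h
    _ = ((2.46 - s) * Real.exp 0.8035 + (s - 1.607) * Real.exp 1.23) / 0.853 := by ring
    _ ≤ _ := div_le_div_of_nonneg_right (by linarith) (by norm_num)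

theorem le_evenFT {s : ℝ} (hs : s ∈ Set.Icc 1.607 2.46) :
    0.447759 ≤ ev transform s * Real.exp (-s / 2) := by
  have h := ev_nonneg_of_nonnegOn (p := add (smul 0.853 transform) (smul (-0.447759)
    (add (smul 2.2333440 [2.46, -1]) (smul 3.4212296 [-1.607, 1])))) 1.607 [2.46001]
    (by decide +kernel) (x := s) (le_trans (by norm_num) hs.1)
    (lt_of_le_of_lt hs.2 (by norm_num [List.getLastD_cons]))
  simp only [ev_add, ev_smul, ev_cons, ev_nil] at h
  push_cast at h
  have he := exp_half_le_chord hs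
  rw [le_div_iff₀ (by norm_num)] at he
  rw [neg_div, Real.exp_neg, ← div_eq_mul_inv, le_div_iff₀ (Real.exp_pos _)]
  linarith

theorem tanhLower_nonneg {x : ℝ} (hx : x ∈ Set.Icc 0 0.7998) : 0 ≤ ev tanhLower x :=
  ev_nonneg_of_nonnegOn 0 [0.8] (by decide +kernel) (by simpa using hx.1)
    (lt_of_le_of_lt hx.2 (by norm_num [List.getLastD_cons]))

theorem tanhLower_le {x : ℝ} (hx : x ∈ Set.Icc 0 0.7998) : ev tanhLower x ≤ Real.tanh (π * x) := by
  refine le_tanh_pi_mul (hasDerivAt_ev tanhLower) (by simp [tanhLower])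
    (fun y hy => tanhLower_nonneg hy) (fun y hy => ?_) hx
  have hlt : y < (0.8 : ℚ) := lt_of_le_of_lt hy.2 (by norm_num)
  have h0 : ((0 : ℚ) : ℝ) ≤ y := by simpa using hy.1
  have h1 := ev_nonneg_of_nonnegOn (p := add [1] (smul (-1) tanhLower)) 0 [0.8]
    (by decide +kernel) h0 hlt
  have h2 := ev_nonneg_of_nonnegOn (p := add (smul 3.14159 (add [1] (smul (-1)
    (mul tanhLower tanhLower)))) (smul (-1) (deriv tanhLower))) 0
    [0.133, 0.266, 0.4, 0.53, 0.67, 0.8] (by decide +kernel) h0 hlt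
  simp only [ev_add, ev_smul, ev_mul, ev_cons, ev_nil] at h1 h2
  push_cast at h1 h2
  have hl := tanhLower_nonneg hy
  have h3 : 0 ≤ 1 - ev tanhLower y ^ 2 := by nlinarith
  have h4 := mul_le_mul_of_nonneg_right Real.pi_gt_d6.le h3
  nlinarith

theorem cofactorLower_le {s : ℝ} (hs : s ∈ Set.Icc 0 (0.7998 ^ 2)) :
    ev cofactorLower s ≤ ev transformCofactor s * Real.exp (-s / 2) := by
  have h := ev_nonneg_of_nonnegOn (p := add (mul transformCofactor expNegHalf)
    (smul (-1) cofactorLower)) 0 [0.64] (by decide +kernel) (x := s) (by simpa using hs.1)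
    (lt_of_le_of_lt hs.2 (by norm_num [List.getLastD_cons]))
  simp only [ev_add, ev_smul, ev_mul] at h
  push_cast at h
  have h1 := mul_le_mul_of_nonneg_left (ev_expNegHalf_le ⟨hs.1, hs.2.trans (by norm_num)⟩)
    (transformCofactor_nonneg hs.1)
  linarith

theorem integral_transform_le :
    ∫ x in Set.Ioi (0 : ℝ), x * (ev transform (x ^ 2) * Real.exp (-x ^ 2 / 2)) * Real.tanh (π * x) ≤
      ev (0 :: primitive 0 majorant) 0.7998 +
      Real.exp (-0.7998 ^ 2 / 2) * ev (expPrimitive (1 / 2) 18 transform) (0.7998 ^ 2) / 2 -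
      Real.exp (-4 * 0.7998 ^ 2) * ev (expPrimitive 4 18 transform) (0.7998 ^ 2) / 17 := by
  have hi := integrable_mul_ev_sq_mul_exp_mul_tanh transform
  rw [← intervalIntegral.integral_interval_add_Ioi (b := 0.7998) hi.integrableOn hi.integrableOn]
  have h1 := intervalIntegral_mul_tanh_le (N := transformCofactor) (n := cofactorLower)
    (l := tanhLower) (a := 0.7998) (by norm_num) (0.7998 ^ 2) (by norm_num)
    (fun s hs => transformCofactor_nonneg hs.1) (fun s hs => cofactorLower_le hs)
    (fun x hx => tanhLower_nonneg hx) (fun x hx => tanhLower_le hx)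
  have h2 := integral_Ioi_mul_tanh_le (p := transform) (g₁ := expPrimitive (1 / 2) 18 transform)
    (g₂ := expPrimitive 4 18 transform) le_rfl
    (fun x hx => transform_nonneg (pow_le_pow_left₀ (by norm_num) hx 2))
    (by decide +kernel) (by decide +kernel)
  have h3 := intervalIntegral_ev (p := majorant) (g := 0 :: primitive 0 majorant)
    (by decide +kernel) 0 0.7998
  have h0 : ev (0 :: primitive 0 majorant) 0 = 0 := by simp
  rw [h0, sub_zero] at h3
  rw [transform] at *
  rw [← majorant, h3] at h1
  linarith

theorem objective_le :
    4 * (ev (0 :: primitive 0 majorant) 0.7998 +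
      Real.exp (-0.7998 ^ 2 / 2) * ev (expPrimitive (1 / 2) 18 transform) (0.7998 ^ 2) / 2 -
      Real.exp (-4 * 0.7998 ^ 2) * ev (expPrimitive 4 18 transform) (0.7998 ^ 2) / 17) -
      ev transform (-(1 / 4)) * Real.exp (1 / 8) ≤ 8.967 * 0.447759 := by
  have e1 : Real.exp (-0.7998 ^ 2 / 2) ≤ 0.726266 := by
    have h : 1.3769064 ≤ Real.exp (0.7998 ^ 2 / 2) := by
      refine le_trans ?_ (Real.sum_le_exp_of_nonneg (by norm_num) 8)
      norm_num [Finset.sum_range_succ, Nat.factorial]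
    rw [neg_div, Real.exp_neg]
    exact (inv_anti₀ (by norm_num) h).trans (by norm_num)
  have e2 : 0.0774 ≤ Real.exp (-4 * 0.7998 ^ 2) := by
    have h : Real.exp 0.63968004 ≤ 1.89588 := by
      refine (Real.exp_bound' (n := 8) (by norm_num) (by norm_num) (by norm_num)).trans ?_
      norm_num [Finset.sum_range_succ, Nat.factorial]
    have h4 : Real.exp (4 * 0.7998 ^ 2) ≤ 1.89588 ^ 4 := by
      calc Real.exp (4 * 0.7998 ^ 2) = Real.exp 0.63968004 ^ 4 := by
            rw [← Real.exp_nat_mul]; norm_num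
        _ ≤ 1.89588 ^ 4 := by gcongr
    rw [neg_mul, Real.exp_neg]
    exact le_trans (by norm_num) (inv_anti₀ (Real.exp_pos _) h4)
  have e3 : Real.exp (1 / 8) ≤ 1.13315 := by
    refine (Real.exp_bound' (n := 6) (by norm_num) (by norm_num) (by norm_num)).trans ?_
    norm_num [Finset.sum_range_succ, Nat.factorial]
  have hq₁ : 0 ≤ evQ (expPrimitive (1 / 2) 18 transform) (0.7998 ^ 2) := by decide +kernel
  have hq₂ : 0 ≤ evQ (expPrimitive 4 18 transform) (0.7998 ^ 2) := by decide +kernel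
  have hq₃ : 0 ≤ -evQ transform (-(1 / 4)) := by decide +kernel
  have hq : 4 * (evQ (0 :: primitive 0 majorant) 0.7998 +
      0.726266 * evQ (expPrimitive (1 / 2) 18 transform) (0.7998 ^ 2) / 2 -
      0.0774 * evQ (expPrimitive 4 18 transform) (0.7998 ^ 2) / 17) -
      evQ transform (-(1 / 4)) * 1.13315 ≤ 8.967 * 0.447759 := by decide +kernel
  have c₀ := ev_ratCast (0 :: primitive 0 majorant) 0.7998
  have c₁ := ev_ratCast (expPrimitive (1 / 2) 18 transform) (0.7998 ^ 2)
  have c₂ := ev_ratCast (expPrimitive 4 18 transform) (0.7998 ^ 2)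
  have c₃ := ev_ratCast transform (-(1 / 4))
  rw [← Rat.cast_nonneg (K := ℝ)] at hq₁ hq₂ hq₃
  rw [← Rat.cast_le (K := ℝ)] at hq
  push_cast at c₀ c₁ c₂ c₃ hq₁ hq₂ hq₃ hq
  rw [← c₁] at hq₁
  rw [← c₂] at hq₂
  rw [← c₃] at hq₃
  rw [← c₀, ← c₁, ← c₂, ← c₃] at hq
  have m₁ := mul_le_mul_of_nonneg_right e1 hq₁
  have m₂ := mul_le_mul_of_nonneg_right e2 hq₂
  have m₃ := mul_le_mul_of_nonneg_left e3 hq₃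
  linarith

end TestFunction

theorem stmt_2 :
    ∃ u : Polynomial ℝ,
      (let f : ℝ → ℝ := gaussPoly u
      let fhat : ℝ → ℝ := evenFT f
      (∀ x : ℝ, f x ≤ 0) ∧
      (∀ lam : ℝ, lam ∈ Set.Icc (1.857 : ℝ) 2.71 → fhat (Real.sqrt (lam - 1 / 4)) ≥ (0.447759 : ℝ)) ∧
      (∀ lam : ℝ, (2.71 : ℝ) ≤ lam → fhat (Real.sqrt (lam - 1 / 4)) ≥ 0) ∧
      (1 / (0.447759 : ℝ)) *
          (4 * (∫ ξ in Set.Ioi (0 : ℝ), ξ * fhat ξ * Real.tanh (π * ξ))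
            - (1 / Real.sqrt (2 * π)) * ∫ x : ℝ, f x * Real.cosh (x / 2)) ≤ 8.967) := by
  have hsqrt : ∀ lam : ℝ, 1.857 ≤ lam → Real.sqrt (lam - 1 / 4) ^ 2 = lam - 1 / 4 :=
    fun lam h => Real.sq_sqrt (by norm_num at h ⊢; linarith)
  refine ⟨toPoly TestFunction.profile, fun x => ?_, fun lam h => ?_, fun lam h => ?_, ?_⟩
  · rw [gaussPoly, eval_toPoly]
    exact mul_nonpos_of_nonpos_of_nonneg (TestFunction.profile_nonpos (sq_nonneg x))
      (Real.exp_pos _).le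
  · rw [TestFunction.evenFT_eq, hsqrt lam h.1]
    refine TestFunction.le_evenFT ⟨?_, ?_⟩
    · linarith [h.1]
    · linarith [h.2]
  · rw [TestFunction.evenFT_eq, hsqrt lam (le_trans (by norm_num) h)]
    exact mul_nonneg (TestFunction.transform_nonneg (by norm_num at h ⊢; linarith))
      (Real.exp_pos _).le
  · have hcosh : (1 / Real.sqrt (2 * π)) *
        ∫ x : ℝ, gaussPoly (toPoly TestFunction.profile) x * Real.cosh (x / 2) =
        ev TestFunction.transform (-(1 / 4)) * Real.exp (1 / 8) := by
      have h := integral_gaussPoly_mul_cosh TestFunction.profile (1 / 2)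
      rw [TestFunction.gaussTransform_profile] at h
      simp only [show ∀ x : ℝ, 1 / 2 * x = x / 2 from fun x => by ring] at h
      rw [h]
      norm_num
    simp only [TestFunction.evenFT_eq]
    rw [hcosh, one_div, inv_mul_le_iff₀ (by norm_num)]
    linarith [TestFunction.integral_transform_le, TestFunction.objective_le]
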